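/- arXiv:2512.13218 — 2 statements merged into one kernel-verified Lean document; each statement's English description precedes it below -/
import Mathlib

section
/- Let M be a quasi-tilting subcategory of d-H. Then Fac_d(M) is closed under extensions (if X → Y → Z is an extriangle with X, Z ∈ Fac_d(M), then Y ∈ Fac_d(M)), closed under d-factors (Fac_d(Fac_d(M)) ⊆ Fac_d(M)), and closed under direct summands. Moreover, M coincides with the class of E-projective objects of Fac_d(M), and Fac_d(M) has enough projectives: every Z ∈ Fac_d(M) admits an extriangle Z' → M' → Z with M' ∈ M, Z' ∈ Fac_d(M), and M' → Z a right M-approximation of Z. -/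
open CategoryTheory CategoryTheory.Limits CategoryTheory.Pretriangulated

universe v u

namespace PaperAIR

variable {C : Type u} [Category.{v} C] [Preadditive C] [HasZeroObject C]
  [HasShift C ℤ] [∀ n : ℤ, (shiftFunctor C n).Additive] [Pretriangulated C]

/-- `f : X ⟶ Y` is a right `𝒳`-approximation of `Y` (relative to `𝒳 ∋ X`). -/
def IsRightApprox (𝒳 : Set C) {X Y : C} (f : X ⟶ Y) : Prop :=
  X ∈ 𝒳 ∧ ∀ X' ∈ 𝒳, ∀ g : X' ⟶ Y, ∃ h : X' ⟶ X, h ≫ f = g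

/-- `𝒳` is contravariantly finite in `C`: every object admits a right `𝒳`-approximation. -/
def ContravariantlyFinite (𝒳 : Set C) : Prop :=
  ∀ Y : C, ∃ (X : C) (f : X ⟶ Y), IsRightApprox 𝒳 f

/-- `𝒳` is contravariantly finite in the full subcategory `𝒞`. -/
def ContravariantlyFiniteIn (𝒞 𝒳 : Set C) : Prop :=
  ∀ Y ∈ 𝒞, ∃ (X : C) (f : X ⟶ Y), IsRightApprox 𝒳 f

/-- `𝒮` is presilting: `Hom(𝒮, 𝒮[i]) = 0` for all `i > 0`. -/
def IsPresilting (𝒮 : Set C) : Prop :=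
  ∀ X ∈ 𝒮, ∀ Y ∈ 𝒮, ∀ i : ℤ, 0 < i → ∀ f : X ⟶ Y⟦i⟧, f = 0

/-- a (strictly full) triangulated subcategory, given by its class of objects. -/
structure IsTriangSub (T : Set C) : Prop where
  iso_closed : ∀ (X Y : C), (X ≅ Y) → X ∈ T → Y ∈ T
  zero_mem : ∀ X : C, IsZero X → X ∈ T
  shift_mem : ∀ X ∈ T, X⟦(1 : ℤ)⟧ ∈ T
  unshift_mem : ∀ X ∈ T, X⟦(-1 : ℤ)⟧ ∈ T
  ext_mem : ∀ (T' : Triangle C), T' ∈ (distTriang C) → T'.obj₁ ∈ T → T'.obj₃ ∈ T → T'.obj₂ ∈ T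

/-- a thick subcategory: a triangulated subcategory closed under direct summands. -/
structure IsThickSub (T : Set C) extends IsTriangSub T : Prop where
  summand_mem : ∀ (X Y : C) (i : X ⟶ Y) (r : Y ⟶ X), i ≫ r = 𝟙 X → Y ∈ T → X ∈ T

/-- the smallest thick subcategory containing `𝒮`. -/
def thickClosure (𝒮 : Set C) : Set C :=
  {X | ∀ T : Set C, IsThickSub T → 𝒮 ⊆ T → X ∈ T}

/-- `𝒮` is a silting subcategory of `C`: presilting, and the smallest triangulated
subcategory containing `𝒮` is `C` itself. -/
def IsSilting (𝒮 : Set C) : Prop :=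
  IsPresilting 𝒮 ∧ ∀ T : Set C, IsTriangSub T → 𝒮 ⊆ T → ∀ X : C, X ∈ T

/-- `𝒮` is a silting subcategory of the (thick, triangulated) subcategory `𝒦`:
presilting, and the smallest triangulated subcategory containing `𝒮` is `𝒦`. -/
def IsSiltingIn (𝒦 𝒮 : Set C) : Prop :=
  𝒮 ⊆ 𝒦 ∧ IsPresilting 𝒮 ∧ ∀ T : Set C, IsTriangSub T → 𝒮 ⊆ T → 𝒦 ⊆ T

/-- the shift `𝒮[n]` of a class of objects (closed under isomorphism). -/
def shiftSet (𝒮 : Set C) (n : ℤ) : Set C :=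
  {X | ∃ Y ∈ 𝒮, Nonempty (X ≅ Y⟦n⟧)}

/-- `𝒜 ∗ ℬ`: objects `Z` fitting in a triangle `A → Z → B → A[1]` with `A ∈ 𝒜`, `B ∈ ℬ`. -/
def star (𝒜 ℬ : Set C) : Set C :=
  {Z | ∃ (A B : C) (_ : A ∈ 𝒜) (_ : B ∈ ℬ) (f : A ⟶ Z) (g : Z ⟶ B) (h : B ⟶ A⟦(1 : ℤ)⟧),
      Triangle.mk f g h ∈ (distTriang C)}

/-- `𝒮^{[p, p+n]} = 𝒮[p] ∗ 𝒮[p+1] ∗ ⋯ ∗ 𝒮[p+n]`. -/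
def intervalFrom (𝒮 : Set C) (p : ℤ) : ℕ → Set C
  | 0 => shiftSet 𝒮 p
  | n + 1 => star (shiftSet 𝒮 p) (intervalFrom 𝒮 (p + 1) n)

/-- `C_𝒳^{≤ 0}`: objects `Y` with `Hom(𝒳, Y[i]) = 0` for all `i > 0`. -/
def leZeroSet (𝒳 : Set C) : Set C :=
  {Y | ∀ X ∈ 𝒳, ∀ i : ℤ, 0 < i → ∀ f : X ⟶ Y⟦i⟧, f = 0}

/-- `C_𝒳^{≥ 0}`: objects `Y` with `Hom(𝒳, Y[i]) = 0` for all `i < 0`. -/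
def geZeroSet (𝒳 : Set C) : Set C :=
  {Y | ∀ X ∈ 𝒳, ∀ i : ℤ, i < 0 → ∀ f : X ⟶ Y⟦i⟧, f = 0}

/-- `(L, G)` is a `t`-structure (with `L = D^{≤0}`, `G = D^{≥0}`). -/
structure IsTStr (L G : Set C) : Prop where
  iso_le : ∀ (X Y : C), (X ≅ Y) → X ∈ L → Y ∈ L
  iso_ge : ∀ (X Y : C), (X ≅ Y) → X ∈ G → Y ∈ G
  shift_le : ∀ X ∈ L, X⟦(1 : ℤ)⟧ ∈ L
  shift_ge : ∀ X ∈ G, X⟦(-1 : ℤ)⟧ ∈ G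
  hom_zero : ∀ X ∈ L, ∀ Y : C, Y⟦(1 : ℤ)⟧ ∈ G → ∀ f : X ⟶ Y, f = 0
  exists_tri : ∀ X : C, ∃ (A B : C) (f : A ⟶ X) (g : X ⟶ B) (h : B ⟶ A⟦(1 : ℤ)⟧),
      Triangle.mk f g h ∈ (distTriang C) ∧ A ∈ L ∧ B⟦(1 : ℤ)⟧ ∈ G

/-- the `d`-extended heart `d`-`H = D^{≤0} ∩ D^{≥ -d+1}` of the `t`-structure
`(D_P^{≤0}, D_P^{≥0})` associated with `P`. -/
def extHeart (P : Set C) (d : ℕ) : Set C :=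
  {X | X ∈ leZeroSet P ∧ X⟦(1 - (d : ℤ))⟧ ∈ geZeroSet P}

/-- an extriangle `A → B → Z` in the `d`-extended heart. -/
def Extriangle (P : Set C) (d : ℕ) (A B Z : C) : Prop :=
  A ∈ extHeart P d ∧ B ∈ extHeart P d ∧ Z ∈ extHeart P d ∧
    ∃ (f : A ⟶ B) (g : B ⟶ Z) (h : Z ⟶ A⟦(1 : ℤ)⟧), Triangle.mk f g h ∈ (distTriang C)

/-- `Fac_s(𝒳)`: the `s`-factors of `𝒳` inside the `d`-extended heart. -/
def Fac (P : Set C) (d : ℕ) (𝒳 : Set C) : ℕ → Set C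
  | 0 => extHeart P d
  | s + 1 => {Z | ∃ Z' ∈ Fac P d 𝒳 s, ∃ B ∈ 𝒳, Extriangle P d Z' B Z}

/-- `T(𝒮) = {X ∈ d-H ∣ Hom(𝒮, X[i]) = 0 for i > 0}`. -/
def TClass (P : Set C) (d : ℕ) (𝒮 : Set C) : Set C :=
  {X | X ∈ extHeart P d ∧ ∀ A ∈ 𝒮, ∀ i : ℤ, 0 < i → ∀ f : A ⟶ X⟦i⟧, f = 0}

/-- `F(𝒮) = {X ∈ d-H ∣ Hom(𝒮, X[i]) = 0 for i ≤ 0}`. -/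
def FClass (P : Set C) (d : ℕ) (𝒮 : Set C) : Set C :=
  {X | X ∈ extHeart P d ∧ ∀ A ∈ 𝒮, ∀ i : ℤ, i ≤ 0 → ∀ f : A ⟶ X⟦i⟧, f = 0}

/-- `(𝒯, ℱ)` is an `s`-torsion pair in the `d`-extended heart. -/
def IsSTorsionPair (P : Set C) (d : ℕ) (𝒯 ℱ : Set C) : Prop :=
  (∀ T ∈ 𝒯, ∀ F ∈ ℱ, ∀ f : T ⟶ F, f = 0) ∧
  (∀ T ∈ 𝒯, ∀ F ∈ ℱ, ∀ f : T ⟶ F⟦(-1 : ℤ)⟧, f = 0) ∧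
  (∀ X ∈ extHeart P d, ∃ (T' : C) (_ : T' ∈ 𝒯) (F' : C) (_ : F' ∈ ℱ), Extriangle P d T' X F')

/-- `M` is (a representative of) `H^{[-d+1,0]}(S)`: there is a triangle
`W → S → M → W[1]` with `W ∈ D^{≤ -d}` and `M ∈ d-H`. -/
def IsHTrunc (P : Set C) (d : ℕ) (S M : C) : Prop :=
  M ∈ extHeart P d ∧
    ∃ (W : C) (f : W ⟶ S) (g : S ⟶ M) (h : M ⟶ W⟦(1 : ℤ)⟧),
      Triangle.mk f g h ∈ (distTriang C) ∧ W⟦-(d : ℤ)⟧ ∈ leZeroSet P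

/-- `H^{[-d+1,0]}(𝒮)` as a class of objects. -/
def hTruncSet (P : Set C) (d : ℕ) (𝒮 : Set C) : Set C :=
  {M | ∃ S ∈ 𝒮, IsHTrunc P d S M}

/-- the additive closure of a class of objects: closure under finite direct sums
(expressed via binary biproduct diagrams and zero objects) and direct summands. -/
inductive AddClos (𝒮 : Set C) : C → Prop
  | of (X : C) (hX : X ∈ 𝒮) : AddClos 𝒮 X
  | zero (X : C) (hX : IsZero X) : AddClos 𝒮 X
  | biprod (X Y Z : C) (i₁ : X ⟶ Z) (i₂ : Y ⟶ Z) (p₁ : Z ⟶ X) (p₂ : Z ⟶ Y)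
      (h₁ : i₁ ≫ p₁ = 𝟙 X) (h₂ : i₂ ≫ p₂ = 𝟙 Y) (h₁₂ : i₁ ≫ p₂ = 0) (h₂₁ : i₂ ≫ p₁ = 0)
      (htot : p₁ ≫ i₁ + p₂ ≫ i₂ = 𝟙 Z) (hX : AddClos 𝒮 X) (hY : AddClos 𝒮 Y) : AddClos 𝒮 Z
  | summand (X Y : C) (i : X ⟶ Y) (r : Y ⟶ X) (hir : i ≫ r = 𝟙 X) (hY : AddClos 𝒮 Y) :
      AddClos 𝒮 X

/-- `add 𝒮` as a set. -/
def addSet (𝒮 : Set C) : Set C := {X | AddClos 𝒮 X}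

/-- `𝒮` is a `P`-presentation of `ℳ ⊆ d-H`: a `(d+1)`-term subcategory of `K`
with `add H^{[-d+1,0]}(𝒮) = ℳ`. -/
def IsPPresentation (P : Set C) (d : ℕ) (ℳ 𝒮 : Set C) : Prop :=
  𝒮 ⊆ intervalFrom P 0 d ∧ addSet (hTruncSet P d 𝒮) = ℳ

/-- `ℳ` is AIR tilting with respect to its `P`-presentation `𝒮`. -/
def IsAIRTiltingWrt (P : Set C) (d : ℕ) (ℳ 𝒮 : Set C) : Prop :=
  IsPPresentation P d ℳ 𝒮 ∧ ContravariantlyFinite 𝒮 ∧ TClass P d 𝒮 = Fac P d ℳ d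

/-- `ℳ` is AIR tilting. -/
def IsAIRTilting (P : Set C) (d : ℕ) (ℳ : Set C) : Prop :=
  ∃ 𝒮 : Set C, IsAIRTiltingWrt P d ℳ 𝒮

/-- `ℳ` is a quasi-tilting subcategory of the `d`-extended heart. -/
def IsQuasiTilting (P : Set C) (d : ℕ) (ℳ : Set C) : Prop :=
  (∀ M ∈ ℳ, ∀ X ∈ Fac P d ℳ d, ∀ f : M ⟶ X⟦(1 : ℤ)⟧, f = 0) ∧
  Fac P d ℳ d = Fac P d ℳ (d + 1)

/-- `M ∈ d-H` has projective dimension at most `m`. -/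
def ProjDimLE (P : Set C) (d : ℕ) : ℕ → C → Prop
  | 0, M => M ∈ P
  | m + 1, M => ∃ (Z Q : C), Q ∈ P ∧ ProjDimLE P d m Z ∧ Extriangle P d Z Q M

/-- `ℳ` is a tilting subcategory of the `d`-extended heart. -/
def IsTilting (P : Set C) (d : ℕ) (ℳ : Set C) : Prop :=
  (∀ M ∈ ℳ, ProjDimLE P d d M) ∧
  (∀ M ∈ ℳ, ∀ M' ∈ ℳ, ∀ i : ℤ, 0 < i → ∀ f : M ⟶ M'⟦i⟧, f = 0) ∧
  (∀ Q ∈ P, ∃ (r : ℕ) (Y : ℕ → C) (M : ℕ → C), Y 0 = Q ∧ Y r ∈ ℳ ∧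
      ∀ i < r, M i ∈ ℳ ∧ Extriangle P d (Y i) (M i) (Y (i + 1)))

/-- `ℳ` is an `E`-universal subcategory of the `d`-extended heart. -/
def EUniversal (P : Set C) (d : ℕ) (ℳ : Set C) : Prop :=
  ∀ X ∈ extHeart P d, ∃ (Y M : C) (_ : M ∈ ℳ) (f : X ⟶ Y) (g : Y ⟶ M)
      (h : M ⟶ X⟦(1 : ℤ)⟧), Triangle.mk f g h ∈ (distTriang C) ∧ Y ∈ extHeart P d ∧
      ∀ M' ∈ ℳ, ∀ e : M' ⟶ X⟦(1 : ℤ)⟧, ∃ φ : M' ⟶ M, φ ≫ h = e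

set_option linter.unusedSectionVars false

section Triangles

variable {X Y Z W : C} {f : X ⟶ Y} {g : Y ⟶ Z} {h : Z ⟶ X⟦(1 : ℤ)⟧}

lemma shift_one_injective {A B : C} {a b : A ⟶ B} (hab : a⟦(1 : ℤ)⟧' = b⟦(1 : ℤ)⟧') : a = b :=
  (shiftFunctor C (1 : ℤ)).map_injective hab

lemma exists_shift_one_eq {A B : C} (a : A⟦(1 : ℤ)⟧ ⟶ B⟦(1 : ℤ)⟧) : 
    ∃ b : A ⟶ B, b⟦(1 : ℤ)⟧' = a :=
  ⟨(shiftFunctor C (1 : ℤ)).preimage a, (shiftFunctor C (1 : ℤ)).map_preimage a⟩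

lemma dist_comp₁₂ (hT : Triangle.mk f g h ∈ distTriang C) : f ≫ g = 0 :=
  comp_distTriang_mor_zero₁₂ _ hT

lemma dist_comp₂₃ (hT : Triangle.mk f g h ∈ distTriang C) : g ≫ h = 0 :=
  comp_distTriang_mor_zero₂₃ _ hT

lemma dist_comp₃₁ (hT : Triangle.mk f g h ∈ distTriang C) : h ≫ f⟦(1 : ℤ)⟧' = 0 :=
  comp_distTriang_mor_zero₃₁ _ hT

lemma dist_lift₁ (hT : Triangle.mk f g h ∈ distTriang C) (t : W ⟶ X⟦(1 : ℤ)⟧)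
    (ht : t ≫ f⟦(1 : ℤ)⟧' = 0) : ∃ s : W ⟶ Z, t = s ≫ h :=
  Triangle.coyoneda_exact₁ _ hT t ht

lemma dist_lift₂ (hT : Triangle.mk f g h ∈ distTriang C) (t : W ⟶ Y) (ht : t ≫ g = 0) :
    ∃ s : W ⟶ X, t = s ≫ f :=
  Triangle.coyoneda_exact₂ _ hT t ht

lemma dist_lift₃ (hT : Triangle.mk f g h ∈ distTriang C) (t : W ⟶ Z) (ht : t ≫ h = 0) :
    ∃ s : W ⟶ Y, t = s ≫ g :=
  Triangle.coyoneda_exact₃ _ hT t ht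

lemma dist_lift_shift (hT : Triangle.mk f g h ∈ distTriang C) (t : W ⟶ X) (ht : t ≫ f = 0) :
    ∃ s : W⟦(1 : ℤ)⟧ ⟶ Z, t⟦(1 : ℤ)⟧' = s ≫ h :=
  dist_lift₁ hT _ (by rw [← Functor.map_comp, ht, Functor.map_zero])

lemma dist_desc₂ (hT : Triangle.mk f g h ∈ distTriang C) (t : Y ⟶ W) (ht : f ≫ t = 0) :
    ∃ s : Z ⟶ W, t = g ≫ s :=
  Triangle.yoneda_exact₂ _ hT t ht

lemma dist_desc₃ (hT : Triangle.mk f g h ∈ distTriang C) (t : Z ⟶ W) (ht : g ≫ t = 0) :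
    ∃ s : X⟦(1 : ℤ)⟧ ⟶ W, t = h ≫ s :=
  Triangle.yoneda_exact₃ _ hT t ht

lemma dist_desc₁ (hT : Triangle.mk f g h ∈ distTriang C) (t : X⟦(1 : ℤ)⟧ ⟶ W) (ht : h ≫ t = 0) :
    ∃ s : Y⟦(1 : ℤ)⟧ ⟶ W, t = f⟦(1 : ℤ)⟧' ≫ s := by
  obtain ⟨s, hs⟩ := Triangle.yoneda_exact₃ _ (rot_of_distTriang _ hT) t ht
  exact ⟨-s, hs.trans ((Preadditive.neg_comp (f⟦(1 : ℤ)⟧') s).trans (Preadditive.comp_neg _ _).symm)⟩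

variable {X' Y' Z' : C} {f' : X' ⟶ Y'} {g' : Y' ⟶ Z'} {h' : Z' ⟶ X'⟦(1 : ℤ)⟧}

lemma dist_map₁ (hT : Triangle.mk f g h ∈ distTriang C) (hT' : Triangle.mk f' g' h' ∈ distTriang C)
    (b : Y ⟶ Y') (c : Z ⟶ Z') (comm : g ≫ c = b ≫ g') :
    ∃ a : X ⟶ X', f ≫ b = a ≫ f' ∧ h ≫ a⟦(1 : ℤ)⟧' = c ≫ h' :=
  complete_distinguished_triangle_morphism₁ _ _ hT hT' b c comm

lemma dist_map₂ (hT : Triangle.mk f g h ∈ distTriang C) (hT' : Triangle.mk f' g' h' ∈ distTriang C)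
    (a : X ⟶ X') (c : Z ⟶ Z') (comm : h ≫ a⟦(1 : ℤ)⟧' = c ≫ h') :
    ∃ b : Y ⟶ Y', f ≫ b = a ≫ f' ∧ g ≫ c = b ≫ g' :=
  complete_distinguished_triangle_morphism₂ _ _ hT hT' a c comm

lemma dist_map₃ (hT : Triangle.mk f g h ∈ distTriang C) (hT' : Triangle.mk f' g' h' ∈ distTriang C)
    (a : X ⟶ X') (b : Y ⟶ Y') (comm : f ≫ b = a ≫ f') :
    ∃ c : Z ⟶ Z', g ≫ c = b ≫ g' ∧ h ≫ a⟦(1 : ℤ)⟧' = c ≫ h' :=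
  complete_distinguished_triangle_morphism _ _ hT hT' a b comm

lemma exists_cocone (g : Y ⟶ Z) : ∃ (X : C) (f : X ⟶ Y) (h : Z ⟶ X⟦(1 : ℤ)⟧),
    Triangle.mk f g h ∈ distTriang C :=
  distinguished_cocone_triangle₁ g

lemma exists_cone (f : X ⟶ Y) : ∃ (Z : C) (g : Y ⟶ Z) (h : Z ⟶ X⟦(1 : ℤ)⟧),
    Triangle.mk f g h ∈ distTriang C :=
  distinguished_cocone_triangle f

lemma exists_extension (h : Z ⟶ X⟦(1 : ℤ)⟧) : ∃ (Y : C) (f : X ⟶ Y) (g : Y ⟶ Z),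
    Triangle.mk f g h ∈ distTriang C :=
  distinguished_cocone_triangle₂ h

lemma dist_of_iso₂ (hT : Triangle.mk f g h ∈ distTriang C) {Y₁ : C} (e : Y₁ ≅ Y) :
    Triangle.mk (f ≫ e.inv) (e.hom ≫ g) h ∈ distTriang C := by
  have c₁ : (f ≫ e.inv) ≫ e.hom = 𝟙 X ≫ f := by simp
  have c₂ : (e.hom ≫ g) ≫ 𝟙 Z = e.hom ≫ g := by simp
  have c₃ : h ≫ (𝟙 X)⟦(1 : ℤ)⟧' = 𝟙 Z ≫ h := by simp
  exact isomorphic_distinguished _ hT _ (Triangle.isoMk _ _ (Iso.refl _) e (Iso.refl _) c₁ c₂ c₃)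

/-- An endomorphism of a triangle which is the identity on the outer terms is invertible. -/
lemma isIso_middle (hT : Triangle.mk f g h ∈ distTriang C) (b : Y ⟶ Y)
    (h₁ : f ≫ b = f) (h₂ : b ≫ g = g) : IsIso b :=
  isIso₂_of_isIso₁₃ (T := Triangle.mk f g h) (T' := Triangle.mk f g h)
    { hom₁ := 𝟙 _, hom₂ := b, hom₃ := 𝟙 _, comm₁ := h₁.trans (Category.id_comp f).symm,
      comm₂ := (Category.comp_id g).trans h₂.symm,
      comm₃ := by
        exact ((congrArg (h ≫ ·) ((shiftFunctor C (1 : ℤ)).map_id X)).trans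
          (Category.comp_id h)).trans (Category.id_comp h).symm } hT hT
    (by dsimp; infer_instance) (by dsimp; infer_instance)

lemma isIso_right (hT : Triangle.mk f g h ∈ distTriang C) (c : Z ⟶ Z)
    (h₁ : g ≫ c = g) (h₂ : c ≫ h = h) : IsIso c :=
  isIso₃_of_isIso₁₂ (T := Triangle.mk f g h) (T' := Triangle.mk f g h)
    { hom₁ := 𝟙 _, hom₂ := 𝟙 _, hom₃ := c,
      comm₁ := (Category.comp_id f).trans (Category.id_comp f).symm,
      comm₂ := h₁.trans (Category.id_comp g).symm,
      comm₃ := by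
        exact ((congrArg (h ≫ ·) ((shiftFunctor C (1 : ℤ)).map_id X)).trans
          (Category.comp_id h)).trans h₂.symm } hT hT
    (by dsimp; infer_instance) (by dsimp; infer_instance)

end Triangles

section Retracts

/-- Given a triangle `X ⟶ Y ⟶ Z` and a lift `b : W ⟶ Y` of a morphism `c : W ⟶ Z`, the cocone of
`X ⊞ W ⟶ Y` is a retract of two copies of the cocone of `c`. -/
lemma cocone_desc_retract {X Y Z K W K' : C} {f : X ⟶ Y} {g : Y ⟶ Z} {δ : Z ⟶ X⟦(1 : ℤ)⟧}
    (hT : Triangle.mk f g δ ∈ distTriang C)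
    {k : K ⟶ W} {c : W ⟶ Z} {h : Z ⟶ K⟦(1 : ℤ)⟧} (hK : Triangle.mk k c h ∈ distTriang C)
    {b : W ⟶ Y} (hb : b ≫ g = c)
    {k' : K' ⟶ X ⊞ W} {h' : Y ⟶ K'⟦(1 : ℤ)⟧}
    (hK' : Triangle.mk k' (biprod.desc f b) h' ∈ distTriang C) :
    ∃ (l₁ : K' ⟶ K) (r₁ : K ⟶ K') (l₂ : K' ⟶ K) (r₂ : K ⟶ K'), l₁ ≫ r₁ + l₂ ≫ r₂ = 𝟙 K' := by
  obtain ⟨e, he₁, he₂⟩ := dist_map₁ hK hT b (𝟙 Z) (by simp [hb])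
  rw [Category.id_comp] at he₂
  obtain ⟨κ, hκ⟩ := dist_lift₂ hK' (biprod.lift (-e) k) (by simp [biprod.lift_desc, he₁])
  have hy : (k' ≫ biprod.snd) ≫ c = 0 := by
    have h0 := dist_comp₁₂ hK'
    have : k' ≫ biprod.desc f b ≫ g = 0 := by rw [← Category.assoc, h0, zero_comp]
    rw [← this]
    simp only [Category.assoc]
    congr 1
    ext <;> simp [hb, dist_comp₁₂ hT]
  obtain ⟨l0, hl0⟩ := dist_lift₂ hK _ hy
  have hx : (l0 ≫ e + k' ≫ biprod.fst) ≫ f = 0 := by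
    have h0 := dist_comp₁₂ hK'
    rw [Preadditive.add_comp, Category.assoc, ← he₁, ← Category.assoc l0, ← hl0, ← h0]
    simp only [Category.assoc, ← Preadditive.comp_add]
    congr 1
    ext <;> simp
  obtain ⟨τ, hτ⟩ := dist_lift_shift hT _ hx
  obtain ⟨τ', hτ'⟩ := exists_shift_one_eq (τ ≫ h)
  have hl_k : (l0 - τ') ≫ k = k' ≫ biprod.snd := by
    have : τ' ≫ k = 0 := shift_one_injective (by
      rw [Functor.map_comp, hτ', Category.assoc, dist_comp₃₁ hK, comp_zero, Functor.map_zero])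
    rw [Preadditive.sub_comp, this, sub_zero, hl0]
  have hl_e : (l0 - τ') ≫ e = - (k' ≫ biprod.fst) := by
    have : τ' ≫ e = l0 ≫ e + k' ≫ biprod.fst := shift_one_injective (by
      rw [Functor.map_comp, hτ', Category.assoc, he₂, hτ])
    rw [Preadditive.sub_comp, this]; abel
  obtain ⟨χ, hχ⟩ := dist_lift_shift hK' (𝟙 K' - (l0 - τ') ≫ κ) (by
    rw [Preadditive.sub_comp, Category.assoc, ← hκ, Category.id_comp]
    rw [sub_eq_zero]
    ext
    · rw [Category.assoc, biprod.lift_fst, Preadditive.comp_neg, hl_e, neg_neg]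
    · rw [Category.assoc, biprod.lift_snd, hl_k])
  have hfh : f ≫ h' = 0 := by
    have := dist_comp₂₃ hK'
    rw [← biprod.inl_desc f b, Category.assoc, this, comp_zero]
  obtain ⟨s, hs⟩ := dist_desc₂ hT h' hfh
  have hcs : c ≫ s = 0 := by
    have := dist_comp₂₃ hK'
    rw [← hb, Category.assoc, ← hs, ← biprod.inr_desc f b, Category.assoc, this, comp_zero]
  obtain ⟨κ₂, hκ₂⟩ := dist_desc₃ hK s hcs
  obtain ⟨r₂, rfl⟩ := exists_shift_one_eq κ₂
  obtain ⟨l₂, hl₂⟩ := exists_shift_one_eq (χ ≫ g ≫ h)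
  refine ⟨l0 - τ', κ, l₂, r₂, shift_one_injective ?_⟩
  have : l₂ ≫ r₂ = 𝟙 K' - (l0 - τ') ≫ κ := shift_one_injective (by
    rw [Functor.map_comp, hl₂, hχ, hs, hκ₂]; simp only [Category.assoc])
  rw [this, add_sub_cancel]

/-- A weak octahedral property: the cocone of a composite `a ≫ β` is a retract of a sum of
copies of the cocone of `β` and of an extension of it by the cocone of `a`. -/
lemma cocone_comp_retract {K M T A Z L E : C} {k : K ⟶ M} {a : M ⟶ T} {h : T ⟶ K⟦(1 : ℤ)⟧}
    (hK : Triangle.mk k a h ∈ distTriang C)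
    {α : A ⟶ T} {β : T ⟶ Z} {η : Z ⟶ A⟦(1 : ℤ)⟧} (hA : Triangle.mk α β η ∈ distTriang C)
    {l : L ⟶ M} {w : Z ⟶ L⟦(1 : ℤ)⟧} (hL : Triangle.mk l (a ≫ β) w ∈ distTriang C)
    {ι : K ⟶ E} {π : E ⟶ A} (hE : Triangle.mk ι π (α ≫ h) ∈ distTriang C) :
    ∃ (l₁ : L ⟶ E) (r₁ : E ⟶ L) (l₂ : L ⟶ E) (r₂ : E ⟶ L) (l₃ : L ⟶ A) (r₃ : A ⟶ L),
      l₁ ≫ r₁ + l₂ ≫ r₂ + l₃ ≫ r₃ = 𝟙 L := by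
  obtain ⟨m, hm₁, hm₂⟩ := dist_map₂ hE hK (𝟙 K) α (by simp)
  rw [Category.id_comp] at hm₁
  obtain ⟨κ, hκ⟩ := dist_lift₂ hL m (by
    rw [← Category.assoc, ← hm₂, Category.assoc, dist_comp₁₂ hA, comp_zero])
  obtain ⟨l0, hl0⟩ := dist_lift₂ hA (l ≫ a) (by rw [Category.assoc, dist_comp₁₂ hL])
  obtain ⟨l1, hl1⟩ := dist_lift₃ hE l0 (by
    rw [← Category.assoc, ← hl0, Category.assoc, dist_comp₂₃ hK, comp_zero])
  obtain ⟨τ, hτ⟩ := dist_lift₂ hK (l1 ≫ m - l) (by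
    rw [Preadditive.sub_comp, Category.assoc, ← hm₂, ← Category.assoc, ← hl1, ← hl0, sub_self])
  have hlm : (l1 - τ ≫ ι) ≫ m = l := by
    rw [Preadditive.sub_comp, Category.assoc, hm₁, ← hτ, sub_sub_cancel]
  obtain ⟨χ, hχ⟩ := dist_lift_shift hL (𝟙 L - (l1 - τ ≫ ι) ≫ κ) (by
    rw [Preadditive.sub_comp, Category.assoc, ← hκ, hlm, Category.id_comp, sub_self])
  obtain ⟨ξ, hξ⟩ := dist_desc₃ hK (β ≫ w) (by rw [← Category.assoc, dist_comp₂₃ hL])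
  obtain ⟨κ₃, hκ₃⟩ := dist_desc₁ hE ξ (by
    rw [Category.assoc, ← hξ, ← Category.assoc, dist_comp₁₂ hA, zero_comp])
  obtain ⟨u, hu⟩ := dist_desc₂ hA (h ≫ ι⟦(1 : ℤ)⟧') (by
    rw [← Category.assoc, dist_comp₃₁ hE])
  obtain ⟨σ, hσ⟩ := dist_desc₃ hA (w - u ≫ κ₃) (by
    rw [Preadditive.comp_sub, hξ, hκ₃, ← Category.assoc, hu, Category.assoc, sub_self])
  obtain ⟨l₂, hl₂⟩ := exists_shift_one_eq (χ ≫ u)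
  obtain ⟨r₂, rfl⟩ := exists_shift_one_eq κ₃
  obtain ⟨l₃, hl₃⟩ := exists_shift_one_eq (χ ≫ η)
  obtain ⟨r₃, rfl⟩ := exists_shift_one_eq σ
  refine ⟨l1 - τ ≫ ι, κ, l₂, r₂, l₃, r₃, ?_⟩
  have : l₂ ≫ r₂ + l₃ ≫ r₃ = 𝟙 L - (l1 - τ ≫ ι) ≫ κ := shift_one_injective (by
    rw [Functor.map_add, Functor.map_comp, Functor.map_comp, hl₂, hl₃, hχ, Category.assoc,
      Category.assoc, ← hσ, ← Preadditive.comp_add, add_sub_cancel])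
  rw [add_assoc, this, add_sub_cancel]

/-- If `a : M ⟶ V` is an approximation with cocone `K` and `W` is a retract of `V`, then the cocone
of `M ⟶ V ⟶ W` is a retract of `K ⊞ M`. -/
lemma cocone_retract {K M V W K' : C} {k : K ⟶ M} {a : M ⟶ V} {v : V ⟶ K⟦(1 : ℤ)⟧}
    (hK : Triangle.mk k a v ∈ distTriang C) {i : W ⟶ V} {r : V ⟶ W} (hir : i ≫ r = 𝟙 W)
    {k' : K' ⟶ M} {w : W ⟶ K'⟦(1 : ℤ)⟧} (hK' : Triangle.mk k' (a ≫ r) w ∈ distTriang C)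
    {s : M ⟶ M} (hs : s ≫ a = a ≫ r ≫ i) :
    ∃ (l₁ : K' ⟶ K) (r₁ : K ⟶ K') (l₂ : K' ⟶ M) (r₂ : M ⟶ K'), l₁ ≫ r₁ + l₂ ≫ r₂ = 𝟙 K' := by
  have hk' := dist_comp₁₂ hK'
  obtain ⟨α, hα⟩ := dist_lift₂ hK (k' ≫ s) (by
    rw [Category.assoc, hs, ← Category.assoc a, ← Category.assoc, hk', zero_comp])
  obtain ⟨β, hβ₁, hβ₂⟩ := dist_map₁ hK hK' (𝟙 M) r (by simp)
  rw [Category.comp_id] at hβ₁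
  obtain ⟨t, ht⟩ := dist_lift₂ hK' (𝟙 M - s) (by
    rw [Preadditive.sub_comp, Category.id_comp, ← Category.assoc s, hs, Category.assoc,
      Category.assoc, hir, Category.comp_id, sub_self])
  obtain ⟨γ, hγ⟩ := dist_lift_shift hK' (𝟙 K' - α ≫ β - k' ≫ t) (by
    rw [Preadditive.sub_comp, Preadditive.sub_comp, Category.assoc, Category.assoc, ← hβ₁, ← ht,
      ← hα]
    simp)
  obtain ⟨γ', hγ'⟩ := exists_shift_one_eq (γ ≫ i ≫ v)
  have hw : i ≫ v ≫ β⟦(1 : ℤ)⟧' = w := by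
    rw [hβ₂, ← Category.assoc, hir, Category.id_comp]
  have : γ' ≫ β = 𝟙 K' - α ≫ β - k' ≫ t := shift_one_injective (by
    rw [Functor.map_comp, hγ', hγ, ← hw]; simp only [Category.assoc])
  refine ⟨α + γ', β, k', t, ?_⟩
  rw [Preadditive.add_comp, this]
  abel

end Retracts

section Tests

/-- All morphisms from objects of `P[n]` to `X` vanish. -/
def Kills (P : Set C) (n : ℤ) (X : C) : Prop :=
  ∀ q ∈ shiftSet P n, ∀ f : q ⟶ X, f = 0

variable {P : Set C}

lemma shift_mem_shiftSet {q : C} {n : ℤ} (hq : q ∈ shiftSet P n) (m : ℤ) :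
    q⟦m⟧ ∈ shiftSet P (n + m) := by
  obtain ⟨p, hp, ⟨e⟩⟩ := hq
  exact ⟨p, hp, ⟨(shiftFunctor C m).mapIso e ≪≫ ((shiftFunctorAdd C n m).app p).symm⟩⟩

lemma kills_shift_iff (n m : ℤ) (X : C) : Kills P n (X⟦m⟧) ↔ Kills P (n - m) X := by
  constructor
  · intro h q hq f
    apply (shiftFunctor C m).map_injective
    rw [Functor.map_zero]
    exact h _ (by simpa using shift_mem_shiftSet hq m) _
  · rintro h q ⟨p, hp, ⟨e⟩⟩ f
    let e' : (p⟦n - m⟧)⟦m⟧ ≅ q := ((shiftFunctorAdd' C (n - m) m n (by simp)).app p).symm ≪≫ e.symm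
    obtain ⟨g, hg⟩ := (shiftFunctor C m).map_surjective (e'.hom ≫ f)
    have : g = 0 := h _ ⟨p, hp, ⟨Iso.refl _⟩⟩ g
    rw [← cancel_epi e'.hom, ← hg, this, Functor.map_zero, comp_zero]

lemma kills_zero_iff (X : C) : Kills P 0 X ↔ ∀ p ∈ P, ∀ f : p ⟶ X, f = 0 := by
  constructor
  · intro h p hp f
    exact h p ⟨p, hp, ⟨((shiftFunctorZero C ℤ).app p).symm⟩⟩ f
  · rintro h q ⟨p, hp, ⟨e⟩⟩ f
    let e' : p ≅ q := ((shiftFunctorZero C ℤ).app p).symm ≪≫ e.symm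
    rw [← cancel_epi e'.hom, h p hp (e'.hom ≫ f), comp_zero]

lemma mem_leZeroSet_iff (X : C) : X ∈ leZeroSet P ↔ ∀ n : ℤ, n < 0 → Kills P n X := by
  constructor
  · intro h n hn
    have := (kills_zero_iff (P := P) (X⟦-n⟧)).2 fun p hp f => h p hp (-n) (by omega) f
    simpa using (kills_shift_iff _ _ _).1 this
  · intro h p hp i hi f
    exact (kills_zero_iff _).1 ((kills_shift_iff 0 i X).2 (h _ (by omega))) p hp f

lemma mem_geZeroSet_iff (X : C) : X ∈ geZeroSet P ↔ ∀ n : ℤ, 0 < n → Kills P n X := by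
  constructor
  · intro h n hn
    have := (kills_zero_iff (P := P) (X⟦-n⟧)).2 fun p hp f => h p hp (-n) (by omega) f
    simpa using (kills_shift_iff _ _ _).1 this
  · intro h p hp i hi f
    exact (kills_zero_iff _).1 ((kills_shift_iff 0 i X).2 (h _ (by omega))) p hp f

lemma mem_extHeart_iff (d : ℕ) (X : C) :
    X ∈ extHeart P d ↔ ∀ n : ℤ, n < 0 ∨ (d : ℤ) ≤ n → Kills P n X := by
  change (X ∈ leZeroSet P ∧ _ ∈ geZeroSet P) ↔ _
  rw [mem_leZeroSet_iff, mem_geZeroSet_iff]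
  constructor
  · rintro ⟨h₁, h₂⟩ n (hn | hn)
    · exact h₁ n hn
    · have := (kills_shift_iff _ _ _).1 (h₂ (n + 1 - d) (by omega))
      rwa [show n + 1 - (d : ℤ) - (1 - d) = n by ring] at this
  · intro h
    exact ⟨fun n hn => h n (Or.inl hn),
      fun n hn => (kills_shift_iff _ _ _).2 (h _ (Or.inr (by omega)))⟩

lemma Kills.retract {n : ℤ} {X Y : C} (hY : Kills P n Y) (i : X ⟶ Y) (r : Y ⟶ X)
    (hir : i ≫ r = 𝟙 X) : Kills P n X := fun q hq f => by
  rw [← Category.comp_id f, ← hir, ← Category.assoc, hY q hq (f ≫ i), zero_comp]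

lemma Kills.middle {n : ℤ} {X Y Z : C} {f : X ⟶ Y} {g : Y ⟶ Z} {h : Z ⟶ X⟦(1 : ℤ)⟧}
    (hT : Triangle.mk f g h ∈ distTriang C) (hX : Kills P n X) (hZ : Kills P n Z) :
    Kills P n Y := fun q hq t => by
  obtain ⟨s, rfl⟩ := dist_lift₂ hT t (hZ q hq _)
  rw [hX q hq s, zero_comp]

variable {d : ℕ}

lemma extHeart_retract {X Y : C} (hY : Y ∈ extHeart P d) (i : X ⟶ Y) (r : Y ⟶ X)
    (hir : i ≫ r = 𝟙 X) : X ∈ extHeart P d := by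
  rw [mem_extHeart_iff] at hY ⊢
  exact fun n hn => (hY n hn).retract i r hir

lemma extHeart_extension {X Y Z : C} {f : X ⟶ Y} {g : Y ⟶ Z} {h : Z ⟶ X⟦(1 : ℤ)⟧}
    (hT : Triangle.mk f g h ∈ distTriang C) (hX : X ∈ extHeart P d) (hZ : Z ∈ extHeart P d) :
    Y ∈ extHeart P d := by
  rw [mem_extHeart_iff] at hX hZ ⊢
  exact fun n hn => (hX n hn).middle hT (hZ n hn)

lemma extHeart_pi {J : Type} [Finite J] {F : J → C} (hF : ∀ j, F j ∈ extHeart P d) :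
    ∏ᶜ F ∈ extHeart P d := by
  rw [mem_extHeart_iff]
  intro n hn q hq f
  refine Limits.Pi.hom_ext _ _ fun j => ?_
  rw [(mem_extHeart_iff d _).1 (hF j) n hn q hq (f ≫ _), zero_comp]

lemma kills_of_isZero {n : ℤ} {X : C} (hX : IsZero X) : Kills P n X :=
  fun _ _ _ => hX.eq_of_tgt _ _

lemma extHeart_zero {X : C} (hX : IsZero X) : X ∈ extHeart P d :=
  (mem_extHeart_iff d X).2 fun _ _ => kills_of_isZero hX

/-- Every morphism from an object of `P[n]` to the target of `φ` lifts along `φ`. -/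
def LiftsTests (P : Set C) (n : ℤ) {V W : C} (φ : V ⟶ W) : Prop :=
  ∀ q ∈ shiftSet P n, ∀ f : q ⟶ W, ∃ f' : q ⟶ V, f = f' ≫ φ

/-- `φ` induces epimorphisms on `Hom(P[n], -)` for `n ≤ e` and monomorphisms for `n < e`. -/
def Connected (P : Set C) (e : ℤ) {V W : C} (φ : V ⟶ W) : Prop :=
  (∀ n ≤ e, LiftsTests P n φ) ∧
    ∀ n < e, ∀ q ∈ shiftSet P n, ∀ g : q ⟶ V, g ≫ φ = 0 → g = 0

lemma liftsTests_of_kills {n : ℤ} {X Y Z : C} {f : X ⟶ Y} {g : Y ⟶ Z} {h : Z ⟶ X⟦(1 : ℤ)⟧}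
    (hT : Triangle.mk f g h ∈ distTriang C) (hX : Kills P (n - 1) X) : LiftsTests P n g :=
  fun q hq t => dist_lift₃ hT t ((kills_shift_iff n 1 X).2 hX q hq _)

lemma LiftsTests.comp {n : ℤ} {X Y Z : C} {φ : X ⟶ Y} {ψ : Y ⟶ Z} (hφ : LiftsTests P n φ)
    (hψ : LiftsTests P n ψ) : LiftsTests P n (φ ≫ ψ) := fun q hq f => by
  obtain ⟨f₁, rfl⟩ := hψ q hq f
  obtain ⟨f₂, rfl⟩ := hφ q hq f₁
  exact ⟨f₂, by rw [Category.assoc]⟩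

lemma extHeart_liftsTests {X Y Z : C} {f : X ⟶ Y} {g : Y ⟶ Z} {h : Z ⟶ X⟦(1 : ℤ)⟧}
    (hT : Triangle.mk f g h ∈ distTriang C) (hX : X ∈ extHeart P d) : LiftsTests P 0 g :=
  liftsTests_of_kills hT ((mem_extHeart_iff d X).1 hX _ (Or.inl (by omega)))

lemma extHeart_cocone {J N V : C} {l : J ⟶ N} {g : N ⟶ V} {w : V ⟶ J⟦(1 : ℤ)⟧}
    (hT : Triangle.mk l g w ∈ distTriang C) (hN : N ∈ extHeart P d) (hV : V ∈ extHeart P d)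
    (hg : LiftsTests P 0 g) : J ∈ extHeart P d := by
  rw [mem_extHeart_iff] at hN hV ⊢
  intro n hn q hq f
  obtain ⟨t, ht⟩ := dist_lift_shift hT f (hN n hn q hq _)
  have hq' := shift_mem_shiftSet hq 1
  suffices t ≫ w = 0 from shift_one_injective (by rw [ht, this, Functor.map_zero])
  by_cases hn' : n + 1 = 0
  · rw [hn'] at hq'
    obtain ⟨t', rfl⟩ := hg _ hq' t
    rw [Category.assoc, dist_comp₂₃ hT, comp_zero]
  · have ht₀ := hV (n + 1) (by omega) _ hq' t
    rw [ht₀, zero_comp]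

/-- Connectivity of `φ` drops by one when passing to the cocones of `g` and `g ≫ φ`. -/
lemma Connected.cocone {e : ℤ} {J N V J' V' : C} {φ : V ⟶ V'} (hφ : Connected P (e + 1) φ)
    {l : J ⟶ N} {g : N ⟶ V} {w : V ⟶ J⟦(1 : ℤ)⟧} (hT : Triangle.mk l g w ∈ distTriang C)
    {l' : J' ⟶ N} {w' : V' ⟶ J'⟦(1 : ℤ)⟧} (hT' : Triangle.mk l' (g ≫ φ) w' ∈ distTriang C) :
    ∃ ψ : J ⟶ J', Connected P e ψ := by
  obtain ⟨ψ, hψ₁, hψ₂⟩ := dist_map₁ hT hT' (𝟙 N) φ (by simp)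
  rw [Category.comp_id] at hψ₁
  refine ⟨ψ, fun n hn q hq f => ?_, fun n hn q hq u hu => ?_⟩
  · have hq' := shift_mem_shiftSet hq 1
    have h0 : (f ≫ l') ≫ g = 0 := hφ.2 n (by omega) q hq _ (by
      rw [Category.assoc, Category.assoc, dist_comp₁₂ hT', comp_zero])
    obtain ⟨u, hu⟩ := dist_lift₂ hT _ h0
    obtain ⟨t, ht⟩ := dist_lift_shift hT' (f - u ≫ ψ) (by
      rw [Preadditive.sub_comp, hu, Category.assoc, ← hψ₁, sub_self])
    obtain ⟨t', rfl⟩ := hφ.1 (n + 1) (by omega) _ hq' t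
    obtain ⟨x, hx⟩ := exists_shift_one_eq (t' ≫ w)
    refine ⟨u + x, shift_one_injective ?_⟩
    have : (x ≫ ψ) = f - u ≫ ψ := shift_one_injective (by
      rw [ht, Functor.map_comp, hx, Category.assoc, Category.assoc, hψ₂])
    rw [Preadditive.add_comp, this, add_sub_cancel]
  · have hq' := shift_mem_shiftSet hq 1
    obtain ⟨t, ht⟩ := dist_lift_shift hT u (by rw [hψ₁, ← Category.assoc, hu, zero_comp])
    obtain ⟨r, hr⟩ := dist_lift₃ hT' (t ≫ φ) (by
      rw [Category.assoc, ← hψ₂, ← Category.assoc, ← ht, ← Functor.map_comp, hu, Functor.map_zero])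
    have : t - r ≫ g = 0 := hφ.2 (n + 1) (by omega) _ hq' _ (by
      rw [Preadditive.sub_comp, hr, Category.assoc, sub_self])
    apply shift_one_injective
    rw [ht, sub_eq_zero.1 this, Category.assoc, dist_comp₂₃ hT, comp_zero, Functor.map_zero]

/-- Truncation: a triangle `A ⟶ X ⟶ B` with `A ∈ D^{≤ -d}` and `B ∈ D^{≥ -d+1}`. -/
lemma exists_truncation (hP : IsTStr (leZeroSet P) (geZeroSet P)) (d : ℕ) (X : C) :
    ∃ (A B : C) (f : A ⟶ X) (g : X ⟶ B) (h : B ⟶ A⟦(1 : ℤ)⟧),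
      Triangle.mk f g h ∈ distTriang C ∧ (∀ n : ℤ, n < d → Kills P n A) ∧
      (∀ n : ℤ, (d : ℤ) ≤ n → Kills P n B) ∧ ∀ Z ∈ extHeart P d, ∀ t : A ⟶ Z, t = 0 := by
  obtain ⟨A, B, f, g, h, hT, hA, hB⟩ := hP.exists_tri (X⟦-(d : ℤ)⟧)
  have hT' := Triangle.shift_distinguished _ hT (d : ℤ)
  let e : X ≅ X⟦-(d : ℤ)⟧⟦(d : ℤ)⟧ :=
    ((shiftFunctorCompIsoId C (-(d : ℤ)) (d : ℤ) (by simp)).app X).symm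
  refine ⟨A⟦(d : ℤ)⟧, B⟦(d : ℤ)⟧, _, _, _, dist_of_iso₂ hT' e,
    fun n hn => ?_, fun n hn => ?_, fun Z hZ t => ?_⟩
  · exact (kills_shift_iff _ _ _).2 ((mem_leZeroSet_iff A).1 hA _ (by omega))
  · have := (kills_shift_iff _ _ _).1 ((mem_geZeroSet_iff _).1 hB (n - d + 1) (by omega))
    rw [add_sub_cancel_right] at this
    exact (kills_shift_iff _ _ _).2 this
  · let e' : Z ≅ Z⟦-(d : ℤ)⟧⟦(d : ℤ)⟧ :=
      ((shiftFunctorCompIsoId C (-(d : ℤ)) (d : ℤ) (by simp)).app Z).symm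
    obtain ⟨s, hs⟩ := (shiftFunctor C (d : ℤ)).map_surjective (t ≫ e'.hom)
    have : s = 0 := hP.hom_zero A hA _ ((mem_geZeroSet_iff _).2 fun n hn =>
      (kills_shift_iff _ _ _).2 ((kills_shift_iff _ _ _).2
        ((mem_extHeart_iff d Z).1 hZ _ (Or.inr (by omega))))) s
    rw [← cancel_mono e'.hom, ← hs, this, Functor.map_zero, zero_comp]

end Tests

section Factors

variable {P : Set C} {d : ℕ} {ℳ : Set C}

lemma fac_subset_extHeart (𝒳 : Set C) (s : ℕ) : Fac P d 𝒳 s ⊆ extHeart P d := by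
  cases s with
  | zero => exact fun _ h => h
  | succ s =>
    rintro Z ⟨_, _, _, _, _, _, hZ, _⟩
    exact hZ

lemma mem_fac_succ {𝒳 : Set C} (h𝒳 : 𝒳 ⊆ extHeart P d) {s : ℕ} {J N Z : C} {f : J ⟶ N}
    {g : N ⟶ Z} {h : Z ⟶ J⟦(1 : ℤ)⟧} (hT : Triangle.mk f g h ∈ distTriang C)
    (hJ : J ∈ Fac P d 𝒳 s) (hN : N ∈ 𝒳) (hZ : Z ∈ extHeart P d) : Z ∈ Fac P d 𝒳 (s + 1) :=
  ⟨J, hJ, N, hN, fac_subset_extHeart _ _ hJ, h𝒳 hN, hZ, f, g, h, hT⟩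

lemma exists_of_mem_fac_succ {𝒳 : Set C} {s : ℕ} {Z : C} (hZ : Z ∈ Fac P d 𝒳 (s + 1)) :
    ∃ (J N : C) (f : J ⟶ N) (g : N ⟶ Z) (h : Z ⟶ J⟦(1 : ℤ)⟧),
      Triangle.mk f g h ∈ distTriang C ∧ J ∈ Fac P d 𝒳 s ∧ N ∈ 𝒳 := by
  obtain ⟨J, hJ, N, hN, _, _, _, f, g, h, hT⟩ := hZ
  exact ⟨J, N, f, g, h, hT, hJ, hN⟩

lemma pi_mem (hadd : addSet ℳ = ℳ) {F : Bool → C} (hF : ∀ j, F j ∈ ℳ) : ∏ᶜ F ∈ ℳ := by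
  have h₀ : ∀ b, AddClos ℳ (F b) := fun b => .of _ (hF b)
  rw [← hadd]
  refine AddClos.biprod (F true) (F false) _
    (Pi.lift fun b => match b with | true => 𝟙 _ | false => 0)
    (Pi.lift fun b => match b with | true => 0 | false => 𝟙 _)
    (Pi.π F true) (Pi.π F false) (by simp) (by simp) (by simp) (by simp) ?_ (h₀ _) (h₀ _)
  refine Limits.Pi.hom_ext _ _ fun b => ?_
  cases b <;> simp

lemma fac_pi (hadd : addSet ℳ = ℳ) (s : ℕ) {F : Bool → C} (hF : ∀ j, F j ∈ Fac P d ℳ s) :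
    ∏ᶜ F ∈ Fac P d ℳ s := by
  induction s generalizing F with
  | zero => exact extHeart_pi hF
  | succ s ih =>
    choose J hJ N hN hJ' hN' hF' f g h hT using hF
    have hprod := productTriangle_distinguished (fun b => Triangle.mk (f b) (g b) (h b)) hT
    exact ⟨_, ih hJ, _, pi_mem hadd hN, extHeart_pi hJ', extHeart_pi hN', extHeart_pi hF',
      _, _, _, hprod⟩

/-- Direct summands of `s`-factors. -/
def RetFac (P : Set C) (d : ℕ) (𝒳 : Set C) (s : ℕ) : Set C :=
  {Z | ∃ V ∈ Fac P d 𝒳 s, ∃ (i : Z ⟶ V) (r : V ⟶ Z), i ≫ r = 𝟙 Z}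

lemma fac_subset_retFac (𝒳 : Set C) (s : ℕ) : Fac P d 𝒳 s ⊆ RetFac P d 𝒳 s :=
  fun Z hZ => ⟨Z, hZ, 𝟙 Z, 𝟙 Z, Category.comp_id _⟩

lemma retFac_subset_extHeart (𝒳 : Set C) (s : ℕ) : RetFac P d 𝒳 s ⊆ extHeart P d := by
  rintro Z ⟨V, hV, i, r, hir⟩
  exact extHeart_retract (fac_subset_extHeart _ _ hV) i r hir

lemma retFac_retract {𝒳 : Set C} {s : ℕ} {X Y : C} (hY : Y ∈ RetFac P d 𝒳 s) (i : X ⟶ Y)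
    (r : Y ⟶ X) (hir : i ≫ r = 𝟙 X) : X ∈ RetFac P d 𝒳 s := by
  obtain ⟨V, hV, i', r', hir'⟩ := hY
  refine ⟨V, hV, i ≫ i', r' ≫ r, ?_⟩
  rw [Category.assoc, ← Category.assoc i', hir', Category.id_comp, hir]

lemma retFac_of_sum (hadd : addSet ℳ = ℳ) {s : ℕ} {X Y₁ Y₂ : C} (h₁ : Y₁ ∈ RetFac P d ℳ s)
    (h₂ : Y₂ ∈ RetFac P d ℳ s) (a₁ : X ⟶ Y₁) (b₁ : Y₁ ⟶ X) (a₂ : X ⟶ Y₂) (b₂ : Y₂ ⟶ X)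
    (hab : a₁ ≫ b₁ + a₂ ≫ b₂ = 𝟙 X) : X ∈ RetFac P d ℳ s := by
  obtain ⟨V₁, hV₁, i₁, r₁, h₁⟩ := h₁
  obtain ⟨V₂, hV₂, i₂, r₂, h₂⟩ := h₂
  let F : Bool → C := fun b => match b with | true => V₁ | false => V₂
  have hF : ∀ b, F b ∈ Fac P d ℳ s := fun b => by
    cases b
    exacts [hV₂, hV₁]
  refine ⟨_, fac_pi hadd s hF,
    Pi.lift (fun b => match b with | true => a₁ ≫ i₁ | false => a₂ ≫ i₂),
    Pi.π F true ≫ r₁ ≫ b₁ + Pi.π F false ≫ r₂ ≫ b₂, ?_⟩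
  rw [Preadditive.comp_add, Pi.lift_π_assoc, Pi.lift_π_assoc, ← hab]
  simp only [Category.assoc]
  rw [← Category.assoc i₁, h₁, ← Category.assoc i₂, h₂, Category.id_comp, Category.id_comp]

lemma retFac_biprod (hadd : addSet ℳ = ℳ) {s : ℕ} {X Y : C} (hX : X ∈ RetFac P d ℳ s)
    (hY : Y ∈ RetFac P d ℳ s) : (X ⊞ Y : C) ∈ RetFac P d ℳ s :=
  retFac_of_sum hadd hX hY biprod.fst biprod.inl biprod.snd biprod.inr biprod.total

open scoped ZeroObject in
lemma zero_mem_fac (hM : ℳ ⊆ extHeart P d) (hadd : addSet ℳ = ℳ) (s : ℕ) :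
    (0 : C) ∈ Fac P d ℳ s := by
  induction s with
  | zero => exact extHeart_zero (isZero_zero C)
  | succ s ih =>
    exact mem_fac_succ hM (contractible_distinguished₁ (0 : C)) ih
      (by rw [← hadd]; exact .zero _ (isZero_zero C)) (extHeart_zero (isZero_zero C))

lemma subset_fac (hM : ℳ ⊆ extHeart P d) (hadd : addSet ℳ = ℳ) (s : ℕ) : ℳ ⊆ Fac P d ℳ s := by
  intro M hM'
  cases s with
  | zero => exact hM hM'
  | succ s =>
    exact mem_fac_succ hM (contractible_distinguished₁ M) (zero_mem_fac hM hadd s) hM' (hM hM')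

lemma Connected.mem_fac (hM : ℳ ⊆ extHeart P d) {s : ℕ} {e : ℤ} {V V' : C} {φ : V ⟶ V'}
    (hφ : Connected P e φ) (hs : (s : ℤ) ≤ e) (hV : V ∈ Fac P d ℳ s) (hV' : V' ∈ extHeart P d) :
    V' ∈ Fac P d ℳ s := by
  induction s generalizing V V' e with
  | zero => exact hV'
  | succ s ih =>
    obtain ⟨J, N, l, g, w, hT, hJ, hN⟩ := exists_of_mem_fac_succ hV
    obtain ⟨J', l', w', hT'⟩ := exists_cocone (g ≫ φ)
    have hJ' : J' ∈ extHeart P d := extHeart_cocone hT' (hM hN) hV'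
      ((extHeart_liftsTests hT (fac_subset_extHeart _ _ hJ)).comp (hφ.1 0 (by omega)))
    obtain ⟨ψ, hψ⟩ := Connected.cocone (e := e - 1) (by simpa using hφ) hT hT'
    exact mem_fac_succ hM hT' (ih hψ (by push_cast at hs; omega) hJ hJ') hN hV'

lemma retFac_succ_of_mem (hP : IsTStr (leZeroSet P) (geZeroSet P)) (hM : ℳ ⊆ extHeart P d)
    {s : ℕ} (hs : s + 1 ≤ d) {J N Z : C} {l : J ⟶ N} {n : N ⟶ Z} {w : Z ⟶ J⟦(1 : ℤ)⟧}
    (hT : Triangle.mk l n w ∈ distTriang C) (hJ : J ∈ RetFac P d ℳ s) (hN : N ∈ ℳ)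
    (hZ : Z ∈ extHeart P d) : Z ∈ RetFac P d ℳ (s + 1) := by
  obtain ⟨V, hV, i, r, hir⟩ := hJ
  have hV' := fac_subset_extHeart _ _ hV
  rw [mem_extHeart_iff] at hV'
  obtain ⟨X, x, y, hX⟩ := exists_cone (r ≫ l)
  obtain ⟨c₁, hc₁, hc₁'⟩ := dist_map₃ hT hX i (𝟙 N) (by
    rw [← Category.assoc, hir, Category.id_comp, Category.comp_id])
  obtain ⟨c₂, hc₂, hc₂'⟩ := dist_map₃ hX hT r (𝟙 N) (by simp)
  rw [Category.id_comp] at hc₁ hc₂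
  have hiso : IsIso (c₁ ≫ c₂) := isIso_right hT _ (by rw [← Category.assoc, hc₁, hc₂]) (by
    rw [Category.assoc, ← hc₂', ← Category.assoc, ← hc₁', Category.assoc, ← Functor.map_comp, hir,
      CategoryTheory.Functor.map_id, Category.comp_id])
  obtain ⟨A, X', a, j, u, hA, hA₁, hA₂, hA₃⟩ := exists_truncation hP d X
  have hj : Connected P d j := by
    refine ⟨fun k hk => liftsTests_of_kills hA (hA₁ _ (by omega)), fun k hk q hq g hg => ?_⟩
    obtain ⟨t, rfl⟩ := dist_lift₂ hA g hg
    rw [hA₁ k hk q hq t, zero_comp]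
  have hx : ∀ k : ℤ, k ≤ 0 → LiftsTests P k x := fun k hk =>
    liftsTests_of_kills hX (hV' _ (Or.inl (by omega)))
  have hX' : X' ∈ extHeart P d := by
    rw [mem_extHeart_iff]
    rintro k (hk | hk)
    · intro q hq f
      obtain ⟨f', rfl⟩ := ((hx k hk.le).comp (hj.1 k (by omega))) q hq f
      rw [(mem_extHeart_iff d N).1 (hM hN) k (Or.inl hk) q hq f', zero_comp]
    · exact hA₂ k hk
  obtain ⟨V', l', w', hV₁⟩ := exists_cocone (x ≫ j)
  have hV₁' : V' ∈ extHeart P d := extHeart_cocone hV₁ (hM hN) hX'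
    ((hx 0 le_rfl).comp (hj.1 0 (by omega)))
  obtain ⟨ψ, hψ⟩ := Connected.cocone (e := d - 1) (by simpa using hj) hX hV₁
  obtain ⟨c₂', hc₂'⟩ := dist_desc₂ hA c₂ (hA₃ Z hZ _)
  refine ⟨X', mem_fac_succ hM hV₁ (hψ.mem_fac hM (by omega) hV hV₁') hN hX', c₁ ≫ j,
    c₂' ≫ inv (c₁ ≫ c₂), ?_⟩
  rw [Category.assoc, ← Category.assoc j, ← hc₂', ← Category.assoc, IsIso.hom_inv_id]

end Factors

section QuasiTilting

variable {P : Set C} {d : ℕ} {ℳ : Set C}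

lemma IsQuasiTilting.exists_triangle (hqt : IsQuasiTilting P d ℳ) {V : C}
    (hV : V ∈ Fac P d ℳ d) : ∃ (K M : C) (k : K ⟶ M) (a : M ⟶ V) (v : V ⟶ K⟦(1 : ℤ)⟧),
      Triangle.mk k a v ∈ distTriang C ∧ K ∈ Fac P d ℳ d ∧ M ∈ ℳ := by
  rw [hqt.2] at hV
  exact exists_of_mem_fac_succ hV

lemma IsQuasiTilting.exists_lift (hqt : IsQuasiTilting P d ℳ) {K M V M' : C} {k : K ⟶ M}
    {a : M ⟶ V} {v : V ⟶ K⟦(1 : ℤ)⟧} (hT : Triangle.mk k a v ∈ distTriang C)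
    (hK : K ∈ Fac P d ℳ d) (hM' : M' ∈ ℳ) (t : M' ⟶ V) : ∃ s : M' ⟶ M, t = s ≫ a :=
  dist_lift₃ hT t (hqt.1 M' hM' K hK _)

lemma IsQuasiTilting.retFac_subset_fac (hM : ℳ ⊆ extHeart P d) (hadd : addSet ℳ = ℳ)
    (hqt : IsQuasiTilting P d ℳ) (s : ℕ) : RetFac P d ℳ d ⊆ Fac P d ℳ s := by
  induction s with
  | zero => exact retFac_subset_extHeart _ _
  | succ s ih =>
    rintro W ⟨V, hV, i, r, hir⟩
    obtain ⟨K, M, k, a, v, hT, hK, hM'⟩ := hqt.exists_triangle hV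
    obtain ⟨t, ht⟩ := hqt.exists_lift hT hK hM' (a ≫ r ≫ i)
    obtain ⟨K', k', w, hK'⟩ := exists_cocone (a ≫ r)
    obtain ⟨l₁, r₁, l₂, r₂, h⟩ := cocone_retract hT hir hK' ht.symm
    exact mem_fac_succ hM hK' (ih (retFac_of_sum hadd (fac_subset_retFac _ _ hK)
      (fac_subset_retFac _ _ (subset_fac hM hadd d hM')) l₁ r₁ l₂ r₂ h)) hM'
      (retFac_subset_extHeart ℳ d ⟨V, hV, i, r, hir⟩)

lemma IsQuasiTilting.retFac_succ_of_extension (hP : IsTStr (leZeroSet P) (geZeroSet P))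
    (hM : ℳ ⊆ extHeart P d) (hadd : addSet ℳ = ℳ) (hqt : IsQuasiTilting P d ℳ)
    {s : ℕ} (hs : s + 1 ≤ d)
    (hext : ∀ {K E J : C} {f : K ⟶ E} {g : E ⟶ J} {h : J ⟶ K⟦(1 : ℤ)⟧},
      Triangle.mk f g h ∈ distTriang C → K ∈ Fac P d ℳ d → J ∈ RetFac P d ℳ s →
      E ∈ RetFac P d ℳ s)
    {J B Z : C} {α : J ⟶ B} {β : B ⟶ Z} {η : Z ⟶ J⟦(1 : ℤ)⟧}
    (hT : Triangle.mk α β η ∈ distTriang C) (hJ : J ∈ RetFac P d ℳ s) (hB : B ∈ Fac P d ℳ d)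
    (hZ : Z ∈ extHeart P d) : Z ∈ RetFac P d ℳ (s + 1) := by
  obtain ⟨K, M, k, a, h, hK, hK', hM'⟩ := hqt.exists_triangle hB
  obtain ⟨L, l, w, hL⟩ := exists_cocone (a ≫ β)
  obtain ⟨E, ι, π, hE⟩ := exists_extension (α ≫ h)
  have hE' := hext hE hK' hJ
  obtain ⟨l₁, r₁, l₂, r₂, l₃, r₃, hlr⟩ := cocone_comp_retract hK hT hL hE
  refine retFac_succ_of_mem hP hM hs hL ?_ hM' hZ
  exact retFac_of_sum hadd (retFac_biprod hadd hE' hE') hJ (biprod.lift l₁ l₂) (biprod.desc r₁ r₂)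
    l₃ r₃ (by rw [biprod.lift_desc, hlr])

lemma IsQuasiTilting.retFac_extension (hP : IsTStr (leZeroSet P) (geZeroSet P))
    (hM : ℳ ⊆ extHeart P d) (hadd : addSet ℳ = ℳ) (hqt : IsQuasiTilting P d ℳ)
    {s : ℕ} (hs : s ≤ d) {K E Z : C} {f : K ⟶ E} {g : E ⟶ Z} {δ : Z ⟶ K⟦(1 : ℤ)⟧}
    (hT : Triangle.mk f g δ ∈ distTriang C) (hK : K ∈ Fac P d ℳ d) (hZ : Z ∈ RetFac P d ℳ s) :
    E ∈ RetFac P d ℳ s := by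
  induction s generalizing K E Z with
  | zero =>
    exact fac_subset_retFac ℳ 0 (extHeart_extension hT (fac_subset_extHeart _ _ hK)
      (retFac_subset_extHeart _ _ hZ))
  | succ s ih =>
    obtain ⟨Z', hZ', i, r, hir⟩ := hZ
    obtain ⟨E', f', g', hT'⟩ := exists_extension (r ≫ δ)
    suffices hE' : E' ∈ RetFac P d ℳ (s + 1) by
      obtain ⟨b₁, hb₁, hb₁'⟩ := dist_map₂ hT hT' (𝟙 K) i (by
        rw [CategoryTheory.Functor.map_id, Category.comp_id, ← Category.assoc, hir,
          Category.id_comp])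
      obtain ⟨b₂, hb₂, hb₂'⟩ := dist_map₂ hT' hT (𝟙 K) r (by simp)
      rw [Category.id_comp] at hb₁ hb₂
      have := isIso_middle hT (b₁ ≫ b₂) (by rw [← Category.assoc, hb₁, hb₂]) (by
        rw [Category.assoc, ← hb₂', ← Category.assoc, ← hb₁', Category.assoc, hir,
          Category.comp_id])
      exact retFac_retract hE' b₁ (b₂ ≫ inv (b₁ ≫ b₂)) (by
        rw [← Category.assoc, IsIso.hom_inv_id])
    obtain ⟨Z₁, M, k, c, h, hZ₁, hZ₁', hM'⟩ := exists_of_mem_fac_succ hZ'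
    obtain ⟨b, hb⟩ := hqt.exists_lift hT' hK hM' c
    obtain ⟨K', k', h', hK'⟩ := exists_cocone (biprod.desc f' b)
    obtain ⟨l₁, r₁, l₂, r₂, hlr⟩ := cocone_desc_retract hT' hZ₁ hb.symm hK'
    have hZ₁'' := fac_subset_retFac _ _ hZ₁'
    exact hqt.retFac_succ_of_extension hP hM hadd hs (ih (by omega)) hK'
      (retFac_of_sum hadd hZ₁'' hZ₁'' l₁ r₁ l₂ r₂ hlr)
      (hqt.retFac_subset_fac hM hadd d (retFac_biprod hadd (fac_subset_retFac _ _ hK)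
        (fac_subset_retFac _ _ (subset_fac hM hadd d hM'))))
      (extHeart_extension hT' (fac_subset_extHeart _ _ hK) (fac_subset_extHeart _ _ hZ'))

lemma IsQuasiTilting.fac_fac_subset (hP : IsTStr (leZeroSet P) (geZeroSet P))
    (hM : ℳ ⊆ extHeart P d) (hadd : addSet ℳ = ℳ) (hqt : IsQuasiTilting P d ℳ)
    {s : ℕ} (hs : s ≤ d) : Fac P d (Fac P d ℳ d) s ⊆ RetFac P d ℳ s := by
  induction s with
  | zero => exact fac_subset_retFac ℳ 0
  | succ s ih =>
    intro Z hZ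
    obtain ⟨J, B, α, β, η, hT, hJ, hB⟩ := exists_of_mem_fac_succ hZ
    exact hqt.retFac_succ_of_extension hP hM hadd hs
      (fun h => hqt.retFac_extension hP hM hadd (by omega) h) hT (ih (by omega) hJ) hB
      (fac_subset_extHeart _ _ hZ)

end QuasiTilting

theorem statement14
    (P : Set C) (hPpre : IsPresilting P) (m : ℤ) (hm : m < 0)
    (hP1 : ∀ X ∈ P, ∀ Y ∈ P, ∀ i : ℤ, i < m → ∀ f : X ⟶ Y⟦i⟧, f = 0)
    (hP2 : IsTStr (leZeroSet P) (geZeroSet P))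
    (d : ℕ) (hd : 0 < d)
    (ℳ : Set C) (hM : ℳ ⊆ extHeart P d) (haddM : addSet ℳ = ℳ)
    (hqt : IsQuasiTilting P d ℳ) :
    (∀ X Y Z : C, Extriangle P d X Y Z → X ∈ Fac P d ℳ d → Z ∈ Fac P d ℳ d →
        Y ∈ Fac P d ℳ d) ∧
    (Fac P d (Fac P d ℳ d) d ⊆ Fac P d ℳ d) ∧
    (∀ (X Y : C) (i : X ⟶ Y) (r : Y ⟶ X), i ≫ r = 𝟙 X →
        Y ∈ Fac P d ℳ d → X ∈ Fac P d ℳ d) ∧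
    (ℳ = {M | M ∈ Fac P d ℳ d ∧ ∀ X ∈ Fac P d ℳ d, ∀ f : M ⟶ X⟦(1 : ℤ)⟧, f = 0}) ∧
    (∀ Z ∈ Fac P d ℳ d, ∃ (Z' M' : C) (_ : Z' ∈ Fac P d ℳ d) (_ : M' ∈ ℳ)
        (f : Z' ⟶ M') (g : M' ⟶ Z) (h : Z ⟶ Z'⟦(1 : ℤ)⟧),
        Triangle.mk f g h ∈ (distTriang C) ∧ IsRightApprox ℳ g) := by
  have hret := hqt.retFac_subset_fac hM haddM d
  refine ⟨?_, fun Z hZ => hret (hqt.fac_fac_subset hP2 hM haddM le_rfl hZ),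
    fun X Y i r hir hY => hret ⟨Y, hY, i, r, hir⟩, Set.Subset.antisymm ?_ ?_, ?_⟩
  · rintro X Y Z ⟨-, -, -, f, g, h, hT⟩ hX hZ
    exact hret (hqt.retFac_extension hP2 hM haddM le_rfl hT hX (fac_subset_retFac _ _ hZ))
  · exact fun M hM' => ⟨subset_fac hM haddM d hM', hqt.1 M hM'⟩
  · rintro X ⟨hX, hX'⟩
    obtain ⟨K, M, k, a, v, hT, hK, hM'⟩ := hqt.exists_triangle hX
    obtain ⟨s, hs⟩ := dist_lift₃ hT (𝟙 X) (hX' K hK _)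
    rw [← haddM]
    exact .summand X M s a hs.symm (.of M hM')
  · intro Z hZ
    obtain ⟨K, M, k, a, v, hT, hK, hM'⟩ := hqt.exists_triangle hZ
    refine ⟨K, M, hK, hM', k, a, v, hT, hM', fun X' hX' g => ?_⟩
    obtain ⟨s, hs⟩ := hqt.exists_lift hT hK hX' g
    exact ⟨s, hs.symm⟩

end PaperAIR
end

section
/- Assume P is contravariantly finite in D and P ⊆ d-H. Let M be a subcategory of d-H and let m be a positive integer. Then every object of M has projective dimension at most m if and only if M ⊆ P^{[0,m]}. -/
open CategoryTheory CategoryTheory.Limits CategoryTheory.Pretriangulated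

universe v u

namespace PaperAIR

variable {C : Type u} [Category.{v} C] [Preadditive C] [HasZeroObject C]
  [HasShift C ℤ] [∀ n : ℤ, (shiftFunctor C n).Additive] [Pretriangulated C]

lemma hom_eq_zero_of_iso {X Y Y' : C} (e : Y ≅ Y') (h : ∀ f : X ⟶ Y, f = 0) (f : X ⟶ Y') :
    f = 0 := by
  rw [← cancel_mono e.inv, zero_comp]
  exact h _

lemma hom_shift_obj₂_eq_zero {X : C} {T : Triangle C} (hT : T ∈ distTriang C) (i : ℤ)
    (h₁ : ∀ f : X ⟶ T.obj₁⟦i⟧, f = 0) (h₃ : ∀ f : X ⟶ T.obj₃⟦i⟧, f = 0)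
    (f : X ⟶ T.obj₂⟦i⟧) : f = 0 := by
  obtain ⟨g, hg⟩ := Triangle.coyoneda_exact₂ _ (T.shift_distinguished hT i) f (h₃ _)
  rw [hg, h₁ g]
  exact zero_comp

lemma exists_distTriang_of_iso {T : Triangle C} (hT : T ∈ distTriang C) {X Y Z : C}
    (e₁ : T.obj₁ ≅ X) (e₂ : T.obj₂ ≅ Y) (e₃ : T.obj₃ ≅ Z) :
    ∃ (f : X ⟶ Y) (g : Y ⟶ Z) (h : Z ⟶ X⟦(1 : ℤ)⟧), Triangle.mk f g h ∈ distTriang C :=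
  ⟨e₁.inv ≫ T.mor₁ ≫ e₂.hom, e₂.inv ≫ T.mor₂ ≫ e₃.hom, e₃.inv ≫ T.mor₃ ≫ e₁.hom⟦(1 : ℤ)⟧',
    isomorphic_distinguished _ hT _ (Triangle.isoMk T (Triangle.mk _ _ _) e₁ e₂ e₃
      (e₁.hom_inv_id_assoc _).symm (e₂.hom_inv_id_assoc _).symm
      (e₃.hom_inv_id_assoc _).symm).symm⟩

lemma mem_extHeart_iff_s17 {P : Set C} {d : ℕ} {X : C} :
    X ∈ extHeart P d ↔ X ∈ leZeroSet P ∧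
      ∀ Q ∈ P, ∀ i : ℤ, i < 1 - (d : ℤ) → ∀ f : Q ⟶ X⟦i⟧, f = 0 := by
  refine and_congr_right fun _ => ⟨fun h Q hQ i hi => ?_, fun h Q hQ i hi => ?_⟩
  · exact hom_eq_zero_of_iso
      ((shiftFunctorAdd' C (1 - (d : ℤ)) (i - (1 - (d : ℤ))) i (by ring)).symm.app X)
      (h Q hQ _ (by linarith))
  · exact hom_eq_zero_of_iso ((shiftFunctorAdd' C (1 - (d : ℤ)) i _ rfl).app X)
      (h Q hQ _ (by linarith))

lemma shift_mem_shiftSet_s17 {P : Set C} {p k q : ℤ} (hq : p + k = q) {X : C}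
    (hX : X ∈ shiftSet P p) : X⟦k⟧ ∈ shiftSet P q := by
  obtain ⟨Q, hQ, ⟨e⟩⟩ := hX
  exact ⟨Q, hQ, ⟨(shiftFunctor C k).mapIso e ≪≫ ((shiftFunctorAdd' C p k q hq).app Q).symm⟩⟩

lemma shift_mem_intervalFrom {P : Set C} (n : ℕ) {p k q : ℤ} (hq : p + k = q) {X : C}
    (hX : X ∈ intervalFrom P p n) : X⟦k⟧ ∈ intervalFrom P q n := by
  induction n generalizing p q X with
  | zero => exact shift_mem_shiftSet_s17 hq hX
  | succ n ih =>
    obtain ⟨A, B, hA, hB, f, g, h, hT⟩ := hX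
    exact ⟨_, _, shift_mem_shiftSet_s17 hq hA, ih (by linarith) hB, _, _, _,
      Triangle.shift_distinguished _ hT k⟩

lemma shiftSet_subset_leZeroSet {P : Set C} (hP : IsPresilting P) {p : ℤ} (hp : 0 ≤ p) :
    shiftSet P p ⊆ leZeroSet P := by
  rintro X ⟨Q, hQ, ⟨e⟩⟩ R hR i hi
  exact hom_eq_zero_of_iso
    ((shiftFunctorAdd' C p i _ rfl).app Q ≪≫ (shiftFunctor C i).mapIso e.symm)
    (hP R hR Q hQ _ (by linarith))

lemma intervalFrom_subset_leZeroSet {P : Set C} (hP : IsPresilting P) (n : ℕ) {p : ℤ}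
    (hp : 0 ≤ p) : intervalFrom P p n ⊆ leZeroSet P := by
  induction n generalizing p with
  | zero => exact shiftSet_subset_leZeroSet hP hp
  | succ n ih =>
    rintro X ⟨A, B, hA, hB, f, g, h, hT⟩ R hR i hi
    exact hom_shift_obj₂_eq_zero hT i (shiftSet_subset_leZeroSet hP hp hA R hR i hi)
      (ih (by linarith) hB R hR i hi)

lemma ProjDimLE.mem_intervalFrom {P : Set C} {d n : ℕ} {M : C} (hM : ProjDimLE P d n M) :
    M ∈ intervalFrom P 0 n := by
  induction n generalizing M with
  | zero => exact ⟨M, hM, ⟨((shiftFunctorZero C ℤ).app M).symm⟩⟩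
  | succ n ih =>
    obtain ⟨Z, Q, hQ, hZ, -, -, -, f, g, h, hT⟩ := hM
    exact ⟨Q, Z⟦(1 : ℤ)⟧, ⟨Q, hQ, ⟨((shiftFunctorZero C ℤ).app Q).symm⟩⟩,
      shift_mem_intervalFrom n rfl (ih hZ), _, _, _, rot_of_distTriang _ hT⟩

/-- In a triangle `Z → Q → M` with `Z ∈ D^{≤ 0}` and `Q`, `M` in the extended heart, `Z` lies in
the extended heart. -/
lemma mem_extHeart_of_distTriang {P : Set C} {d : ℕ} {T : Triangle C} (hT : T ∈ distTriang C)
    (h₁ : T.obj₁ ∈ leZeroSet P) (h₂ : T.obj₂ ∈ extHeart P d) (h₃ : T.obj₃ ∈ extHeart P d) :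
    T.obj₁ ∈ extHeart P d := by
  rw [mem_extHeart_iff_s17] at *
  refine ⟨h₁, fun R hR i hi => ?_⟩
  exact hom_shift_obj₂_eq_zero (inv_rot_of_distTriang _ hT) i
    (hom_eq_zero_of_iso ((shiftFunctorAdd' C (-1) i _ rfl).app _) (h₃.2 R hR _ (by linarith)))
    (h₂.2 R hR i hi)

lemma projDimLE_succ_of_mem_intervalFrom {P : Set C} (hP : IsPresilting P) {d : ℕ}
    (hPH : P ⊆ extHeart P d) (n : ℕ) {M : C} (hM : M ∈ extHeart P d)
    (hMn : M ∈ intervalFrom P 0 (n + 1)) : ProjDimLE P d (n + 1) M := by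
  induction n generalizing M with
  | zero =>
    obtain ⟨A, B, ⟨Q, hQ, ⟨e⟩⟩, hB, f, g, h, hT⟩ := hMn
    obtain ⟨Q', hQ', ⟨e'⟩⟩ := shift_mem_intervalFrom (k := -1) (q := 0) 0 (by norm_num) hB
    exact ⟨Q', Q, hQ, hQ', hPH hQ', hPH hQ, hM,
      exists_distTriang_of_iso (inv_rot_of_distTriang _ hT)
        (e' ≪≫ (shiftFunctorZero C ℤ).app Q') (e ≪≫ (shiftFunctorZero C ℤ).app Q) (Iso.refl M)⟩
  | succ n ih =>
    obtain ⟨A, B, ⟨Q, hQ, ⟨e⟩⟩, hB, f, g, h, hT⟩ := hMn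
    have hZ := shift_mem_intervalFrom (k := -1) (q := 0) (n + 1) (by norm_num) hB
    obtain ⟨f', g', h', hT'⟩ := exists_distTriang_of_iso (inv_rot_of_distTriang _ hT)
      (Iso.refl (B⟦(-1 : ℤ)⟧)) (e ≪≫ (shiftFunctorZero C ℤ).app Q) (Iso.refl M)
    have hZH : B⟦(-1 : ℤ)⟧ ∈ extHeart P d :=
      mem_extHeart_of_distTriang hT' (intervalFrom_subset_leZeroSet hP _ le_rfl hZ) (hPH hQ) hM
    exact ⟨B⟦(-1 : ℤ)⟧, Q, hQ, ih hZH hZ, hZH, hPH hQ, hM, f', g', h', hT'⟩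

theorem statement17
    (P : Set C) (hPpre : IsPresilting P) (m : ℤ) (hm : m < 0)
    (hP1 : ∀ X ∈ P, ∀ Y ∈ P, ∀ i : ℤ, i < m → ∀ f : X ⟶ Y⟦i⟧, f = 0)
    (hP2 : IsTStr (leZeroSet P) (geZeroSet P))
    (d : ℕ) (hd : 0 < d)
    (hPcf : ContravariantlyFinite P) (hPH : P ⊆ extHeart P d)
    (ℳ : Set C) (hM : ℳ ⊆ extHeart P d) (n : ℕ) (hn : 0 < n) :
    (∀ M ∈ ℳ, ProjDimLE P d n M) ↔ ℳ ⊆ intervalFrom P 0 n := by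
  refine ⟨fun h M hMM => (h M hMM).mem_intervalFrom, fun h M hMM => ?_⟩
  obtain ⟨k, rfl⟩ := Nat.exists_eq_succ_of_ne_zero hn.ne'
  exact projDimLE_succ_of_mem_intervalFrom hPpre hPH k (hM hMM) (h hMM)

end PaperAIR
end
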